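/- For every h ≥ 7, the extremal balanced tree 𝒯_h is a stable tree of the tree connection game with n_h − 1 agents, and its social cost satisfies sc_h > 2.4317 · (n_h − 1). Since the social optimum with n_h − 1 agents has cost n_h − 1, the Price of Anarchy of the tree connection game is at least 2.4317. -/

import Mathlib

open Function
open scoped ENNReal Classical

noncomputable section

namespace TCG

variable {n : ℕ}

/-- In-degree of node `v` in the network induced by profile `s` with root `r`:
the number of activated edges `(u, v)` with `u` an agent (a non-root node). -/
def indeg (r : Fin (n + 1)) (s : Fin (n + 1) → Fin (n + 1)) (v : Fin (n + 1)) : ℕ :=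
  Nat.card {u : Fin (n + 1) | u ≠ r ∧ s u = v}

/-- `|T(u)|`: the number of nodes having a directed path to `u` (including `u` itself). -/
def subtreeSize (s : Fin (n + 1) → Fin (n + 1)) (u : Fin (n + 1)) : ℕ :=
  Nat.card {w : Fin (n + 1) | ∃ k, s^[k] w = u}

/-- Cost of the agent at node `v` with respect to the root `r`:
the sum, over the edges `(u, u')` of the unique directed path from `v` to `r`,
of `indeg(u') / |T(u)|`; the cost is `∞` if no such path exists. -/
def cost (r : Fin (n + 1)) (s : Fin (n + 1) → Fin (n + 1)) (v : Fin (n + 1)) : ℝ≥0∞ :=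
  if h : ∃ k, s^[k] v = r then
    ∑ k ∈ Finset.range (Nat.find h),
      (indeg r s (s^[k + 1] v) : ℝ≥0∞) / (subtreeSize s (s^[k] v) : ℝ≥0∞)
  else ⊤

/-- A valid strategy profile: the root is absorbing (a formal convention encoding that the
root activates no edge), and every agent chooses a node different from herself. -/
def ValidProfile (r : Fin (n + 1)) (s : Fin (n + 1) → Fin (n + 1)) : Prop :=
  s r = r ∧ ∀ v, v ≠ r → s v ≠ v

/-- Pure Nash equilibrium (the induced network is *stable*): no agent can strictly
decrease her cost by unilaterally switching her activated edge to another node. -/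
def IsStable (r : Fin (n + 1)) (s : Fin (n + 1) → Fin (n + 1)) : Prop :=
  ValidProfile r s ∧
    ∀ v, v ≠ r → ∀ w, w ≠ v → cost r s v ≤ cost r (Function.update s v w) v

/-- Social cost: the sum of the costs of all agents (the non-root nodes). -/
def SC (s : Fin (n + 1) → Fin (n + 1)) : ℝ≥0∞ :=
  ∑ v ∈ Finset.univ.erase (0 : Fin (n + 1)), cost 0 s v

/-- Height of the induced network: the maximum length of a (leaf-to-)root path,
i.e. the least `k` such that every node arrives at the root after `k` steps. -/
def height (s : Fin (n + 1) → Fin (n + 1)) : ℕ :=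
  sInf {k | ∀ v, s^[k] v = 0}

/-- Fairness Ratio: maximum agent cost divided by minimum agent cost. -/
def FR (s : Fin (n + 1) → Fin (n + 1)) : ℝ≥0∞ :=
  (⨆ (v : Fin (n + 1)) (_ : v ≠ 0), cost 0 s v) /
    (⨅ (v : Fin (n + 1)) (_ : v ≠ 0), cost 0 s v)

/-- The in-degree, at distance `k` from the leaves, in the extremal balanced tree:
`0, 1, 2, 4`, then `d ↦ 2d + 1`. -/
def extDeg : ℕ → ℕ
  | 0 => 0
  | 1 => 1
  | 2 => 2
  | 3 => 4
  | (k + 4) => 2 * extDeg (k + 3) + 1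

/-- `n_h`: the number of nodes (root included) of the extremal balanced tree `𝒯_h`. -/
def extSize : ℕ → ℕ
  | 0 => 1
  | (k + 1) => extDeg (k + 1) * extSize k + 1

/-- `sc_h = Σ_v indeg(v)²`: the social cost of the extremal balanced tree `𝒯_h`. -/
def extSC : ℕ → ℕ
  | 0 => 0
  | (k + 1) => extDeg (k + 1) * extSC k + (extDeg (k + 1)) ^ 2

/-! ### The degrees and sizes of the extremal balanced tree -/

theorem extDeg_pos : ∀ k, 0 < extDeg (k + 1)
  | 0 | 1 | 2 => by simp [extDeg]
  | k + 3 => by simp [extDeg]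

theorem two_mul_extDeg_le : ∀ k, 2 * extDeg k ≤ extDeg (k + 1)
  | 0 | 1 | 2 => by simp [extDeg]
  | k + 3 => by simp [extDeg]

theorem extDeg_succ_le : ∀ k, extDeg (k + 1) ≤ 2 * extDeg k + 1
  | 0 | 1 | 2 => by simp [extDeg]
  | k + 3 => by simp [extDeg]

theorem extDeg_mono : Monotone extDeg :=
  monotone_nat_of_le_succ fun k => by have := two_mul_extDeg_le k; omega

theorem extSize_pos : ∀ k, 0 < extSize k
  | 0 => by simp [extSize]
  | k + 1 => by simp [extSize]

theorem extSize_mono : Monotone extSize :=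
  monotone_nat_of_le_succ fun k => by
    have := Nat.le_mul_of_pos_left (extSize k) (extDeg_pos k)
    simp only [extSize]
    omega

theorem extSize_pos_real (k : ℕ) : (0 : ℝ) < extSize k := by
  exact_mod_cast extSize_pos k

theorem lt_extSC {h : ℕ} (hh : 7 ≤ h) :
    (2.4317 : ℝ) * ((extSize h : ℝ) - 1) < (extSC h : ℝ) := by
  induction h, hh using Nat.le_induction with
  | base => norm_num [extSize, extSC, extDeg]
  | succ k hk ih =>
    have h4 : (4 : ℝ) ≤ extDeg (k + 1) := by
      exact_mod_cast extDeg_mono (show 3 ≤ k + 1 by omega)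
    simp only [extSize, extSC]
    push_cast
    nlinarith

/-! ### The cost comparison between levels -/

/-- The cost of climbing from level `k` to level `m` in the extremal tree. -/
def climb (k m : ℕ) : ℝ :=
  ∑ i ∈ Finset.Ico k m, (extDeg (i + 1) : ℝ) / extSize i

/-- The cost of climbing from level `j` to level `m` when every subtree on the way has been
enlarged by a subtree of height `k`. -/
def sharedClimb (k j m : ℕ) : ℝ :=
  ∑ i ∈ Finset.Ico j m, (extDeg (i + 1) : ℝ) / ((extSize i : ℝ) + extSize k)

theorem climb_nonneg (k m : ℕ) : 0 ≤ climb k m :=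
  Finset.sum_nonneg fun _ _ => by positivity

/-- The cost, multiplied by `extSize k`, for the root of a subtree of height `k` to
connect to a node of level `j` and to climb from there to level `m`. -/
def moveCost (k j m : ℕ) : ℝ :=
  (extDeg j : ℝ) + 1 + extSize k * sharedClimb k j m

theorem moveCost_eq_step {k j m : ℕ} (hjm : j < m) :
    moveCost k j m = moveCost k (j + 1) m + extDeg j
      - extDeg (j + 1) * extSize j / ((extSize j : ℝ) + extSize k) := by
  have h1 := extSize_pos_real j
  have h2 := extSize_pos_real k
  simp only [moveCost, sharedClimb]
  rw [Finset.sum_eq_sum_Ico_succ_bot hjm]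
  field_simp
  ring

theorem moveCost_succ_of_le {k j m : ℕ} (hkj : k ≤ j) (hjm : j < m) :
    moveCost k j m ≤ moveCost k (j + 1) m := by
  rw [moveCost_eq_step hjm]
  have h1 := extSize_pos_real j
  have h2 := extSize_pos_real k
  have h3 : (extSize k : ℝ) ≤ extSize j := by exact_mod_cast extSize_mono hkj
  have h4 : 2 * (extDeg j : ℝ) ≤ extDeg (j + 1) := by exact_mod_cast two_mul_extDeg_le j
  have h5 : (0 : ℝ) ≤ extDeg (j + 1) := by positivity
  have : (extDeg j : ℝ) ≤ extDeg (j + 1) * extSize j / ((extSize j : ℝ) + extSize k) := by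
    rw [le_div_iff₀ (by positivity)]
    nlinarith
  linarith

theorem moveCost_le_of_le {k j m : ℕ} (hkj : k ≤ j) (hjm : j ≤ m) :
    moveCost k k m ≤ moveCost k j m := by
  induction j, hkj using Nat.le_induction with
  | base => exact le_rfl
  | succ j hkj ih => exact (ih (by omega)).trans (moveCost_succ_of_le hkj hjm)

theorem moveCost_succ_le {k j : ℕ} (hj : 1 ≤ j) (hjk : j < k) :
    moveCost k (j + 1) k ≤ moveCost k j k := by
  rw [moveCost_eq_step hjk]
  have h1 := extSize_pos_real j
  have h2 := extSize_pos_real k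
  have h3 : (extSize (j + 1) : ℝ) ≤ extSize k := by exact_mod_cast extSize_mono hjk
  have h4 : (1 : ℝ) ≤ extDeg j := by exact_mod_cast extDeg_mono hj
  simp only [extSize] at h3
  push_cast at h3
  have : extDeg (j + 1) * extSize j / ((extSize j : ℝ) + extSize k) ≤ 1 := by
    rw [div_le_one (by positivity)]
    linarith
  linarith

theorem moveCost_self (k : ℕ) : moveCost k k k = extDeg k + 1 := by
  simp [moveCost, sharedClimb]

theorem le_moveCost_of_pos {k j : ℕ} (hj : 1 ≤ j) (hjk : j ≤ k) :
    (extDeg k : ℝ) + 1 ≤ moveCost k j k := by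
  induction hjk using Nat.decreasingInduction with
  | self => exact (moveCost_self k).ge
  | of_succ j hjk ih => exact (ih (by omega)).trans (moveCost_succ_le hj hjk)

theorem le_moveCost {k j : ℕ} (hk : k ≠ 1) (hjk : j ≤ k) :
    (extDeg k : ℝ) + 1 ≤ moveCost k j k := by
  rcases Nat.eq_zero_or_pos j with rfl | hj
  · rcases Nat.eq_zero_or_pos k with rfl | hk0
    · exact (moveCost_self 0).ge
    · have hk2 : 2 ≤ k := by omega
      refine (le_moveCost_of_pos one_le_two hk2).trans ?_
      rw [moveCost_eq_step (show 0 < k by omega), moveCost_eq_step (show 0 + 1 < k by omega)]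
      have h5 : (5 : ℝ) ≤ extSize k := by exact_mod_cast extSize_mono hk2
      simp only [extDeg, extSize]
      have h1 : (1 : ℝ) / (1 + extSize k) ≤ 1 / 6 := by
        gcongr; linarith
      have h2 : (4 : ℝ) / (2 + extSize k) ≤ 4 / 7 := by
        gcongr; linarith
      norm_num at h1 h2 ⊢
      linarith
  · exact le_moveCost_of_pos hj hjk

theorem le_moveCost_one {j : ℕ} (hj : j ≤ 1) : (5 / 3 : ℝ) ≤ moveCost 1 j 1 := by
  interval_cases j
  · rw [moveCost_eq_step one_pos, moveCost_self]
    norm_num [extDeg, extSize]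
  · rw [moveCost_self]
    norm_num [extDeg]

/-- The unavoidable part of the cost, minus the part saved by the current connection. -/
theorem half_le_moveCost_sub (k j : ℕ) (hjk : j ≤ k) :
    (if k = 1 then 2 / 3 else 1 / 2 : ℝ) ≤ moveCost k j k - extDeg (k + 1) / 2 := by
  split_ifs with hk
  · subst hk
    have := le_moveCost_one hjk
    norm_num [extDeg]
    linarith
  · have h1 := le_moveCost hk hjk
    have h2 : (extDeg (k + 1) : ℝ) ≤ 2 * extDeg k + 1 := by exact_mod_cast extDeg_succ_le k
    linarith

/-- The cost, multiplied by `extSize k`, saved between the levels `a` and `m` by sharing the path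
with a subtree of height `k`. -/
def sharingGain (k a m : ℕ) : ℝ :=
  extSize k * (climb a m - sharedClimb k a m)

theorem sharingGain_step {k a m : ℕ} (h : a < m) :
    sharingGain k a m = extDeg (a + 1) * (extSize k : ℝ) ^ 2 /
      (extSize a * (extSize a + extSize k)) + sharingGain k (a + 1) m := by
  have h1 := extSize_pos_real a
  have h2 := extSize_pos_real k
  simp only [sharingGain, climb, sharedClimb]
  rw [Finset.sum_eq_sum_Ico_succ_bot h, Finset.sum_eq_sum_Ico_succ_bot h]
  field_simp
  ring

theorem sharingGain_self_of_le {k a m : ℕ} (h : m ≤ a) : sharingGain k a m = 0 := by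
  simp [sharingGain, climb, sharedClimb, Finset.Ico_eq_empty_of_le h]

theorem two_mul_ratio_le {i : ℕ} (hi : 2 ≤ i) :
    2 * (extDeg (i + 2) : ℝ) / (extSize (i + 1) : ℝ) ^ 2 ≤
      extDeg (i + 1) / (extSize i : ℝ) ^ 2 := by
  have h1 := extSize_pos_real i
  have h4 : (4 : ℝ) ≤ extDeg (i + 1) := by
    exact_mod_cast extDeg_mono (show 3 ≤ i + 1 by omega)
  have h5 : (extDeg (i + 2) : ℝ) ≤ 2 * extDeg (i + 1) + 1 := by
    exact_mod_cast extDeg_succ_le (i + 1)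
  have h6 : (extDeg (i + 1) * extSize i : ℝ) ≤ extSize (i + 1) := by
    simp [extSize]
  calc 2 * (extDeg (i + 2) : ℝ) / (extSize (i + 1) : ℝ) ^ 2
      ≤ 2 * (2 * extDeg (i + 1) + 1) / (extDeg (i + 1) * extSize i : ℝ) ^ 2 := by gcongr
    _ ≤ extDeg (i + 1) / (extSize i : ℝ) ^ 2 := by
      rw [div_le_div_iff₀ (by positivity) (by positivity), mul_pow, ← mul_assoc]
      gcongr <;> nlinarith

theorem sharingGain_le {k a m : ℕ} (ha : 2 ≤ a) :
    sharingGain k a m ≤ 2 * extDeg (a + 1) * (extSize k : ℝ) ^ 2 / (extSize a : ℝ) ^ 2 := by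
  rcases le_total m a with h | h
  · rw [sharingGain_self_of_le h]
    positivity
  · induction h using Nat.decreasingInduction with
    | self =>
      rw [sharingGain_self_of_le le_rfl]
      positivity
    | of_succ a ham ih =>
      have h1 := extSize_pos_real a
      have h2 := extSize_pos_real k
      rw [sharingGain_step ham]
      have h3 := ih (by omega)
      have h4 := mul_le_mul_of_nonneg_left (two_mul_ratio_le ha) (sq_nonneg (extSize k : ℝ))
      have h5 : extDeg (a + 1) * (extSize k : ℝ) ^ 2 / (extSize a * (extSize a + extSize k)) ≤
          extDeg (a + 1) * (extSize k : ℝ) ^ 2 / (extSize a : ℝ) ^ 2 := by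
        gcongr
        nlinarith
      calc _ ≤ _ := add_le_add h5 h3
        _ = extDeg (a + 1) * (extSize k : ℝ) ^ 2 / (extSize a : ℝ) ^ 2 + (extSize k : ℝ) ^ 2 *
            (2 * (extDeg (a + 2) : ℝ) / (extSize (a + 1) : ℝ) ^ 2) := by ring
        _ ≤ _ := add_le_add_right h4 _
        _ = _ := by ring

theorem sharingGain_le_step (k a m : ℕ) :
    sharingGain k a m ≤ extDeg (a + 1) * (extSize k : ℝ) ^ 2 /
      (extSize a * (extSize a + extSize k)) + sharingGain k (a + 1) m := by
  rcases lt_or_ge a m with h | h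
  · exact (sharingGain_step h).le
  · rw [sharingGain_self_of_le h, sharingGain_self_of_le (by omega)]
    positivity

theorem sharingGain_le_half (k m : ℕ) :
    sharingGain k (k + 1) m ≤ if k = 1 then 2 / 3 else 1 / 2 := by
  have tail := sharingGain_le (k := k) (a := 4) (m := m) (by norm_num)
  have s1 := sharingGain_le_step k 1 m
  have s2 := sharingGain_le_step k 2 m
  have s3 := sharingGain_le_step k 3 m
  match k with
  | 0 =>
    norm_num [extDeg, extSize] at *
    linarith
  | 1 =>
    norm_num [extDeg, extSize] at *
    linarith
  | 2 =>
    norm_num [extDeg, extSize] at *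
    linarith
  | k + 3 =>
    rw [if_neg (by omega)]
    refine (sharingGain_le (by omega)).trans ?_
    have h1 := extSize_pos_real (k + 3)
    have h9 : (9 : ℝ) ≤ extDeg (k + 3 + 1) := by
      exact_mod_cast extDeg_mono (show 4 ≤ k + 3 + 1 by omega)
    have h5 : (extDeg (k + 3 + 1 + 1) : ℝ) ≤ 2 * extDeg (k + 3 + 1) + 1 := by
      exact_mod_cast extDeg_succ_le (k + 3 + 1)
    have h6 : (extDeg (k + 3 + 1) * extSize (k + 3) : ℝ) ≤ extSize (k + 3 + 1) := by
      simp [extSize]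
    calc _ ≤ 2 * (2 * (extDeg (k + 3 + 1) : ℝ) + 1) * (extSize (k + 3) : ℝ) ^ 2 /
          (extDeg (k + 3 + 1) * extSize (k + 3) : ℝ) ^ 2 := by gcongr
      _ ≤ 1 / 2 := by
        rw [div_le_div_iff₀ (by positivity) (by positivity), mul_pow]
        have := sq_nonneg (extSize (k + 3) : ℝ)
        have h7 : 4 * (2 * (extDeg (k + 3 + 1) : ℝ) + 1) ≤ (extDeg (k + 3 + 1) : ℝ) ^ 2 := by
          nlinarith
        nlinarith

theorem moveCost_split {k j m : ℕ} (hjk : j ≤ k) (hkm : k < m) :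
    moveCost k j m = moveCost k j k + extDeg (k + 1) / 2 + extSize k * sharedClimb k (k + 1) m := by
  have h2 := extSize_pos_real k
  simp only [moveCost, sharedClimb]
  rw [← Finset.sum_Ico_consecutive _ hjk hkm.le, Finset.sum_eq_sum_Ico_succ_bot hkm]
  field_simp
  ring

theorem climb_le_moveCost_of_le {k j m : ℕ} (hjk : j ≤ k) (hkm : k < m) :
    extSize k * climb k m ≤ moveCost k j m := by
  have h0 := extSize_pos_real k
  have h1 := half_le_moveCost_sub k j hjk
  have h2 := sharingGain_le_half k m
  rw [moveCost_split hjk hkm, climb, Finset.sum_eq_sum_Ico_succ_bot hkm, ← climb, mul_add,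
    mul_div_cancel₀ _ h0.ne']
  simp only [sharingGain, mul_sub] at h2
  linarith

/-- Moving to a node of level `j`, with lowest common ancestor at level `m`, is not profitable. -/
theorem climb_le_moveCost {k j m : ℕ} (hjm : j ≤ m) (hkm : k < m) :
    extSize k * climb k m ≤ moveCost k j m := by
  rcases le_total j k with h | h
  · exact climb_le_moveCost_of_le h hkm
  · exact (climb_le_moveCost_of_le le_rfl hkm).trans (moveCost_le_of_le h hjm)

/-- Moving within the subtree of the current parent is not profitable. -/
theorem climb_succ_le_moveCost {k j : ℕ} (hjk : j ≤ k) :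
    extSize k * climb k (k + 1) + 1 / 2 ≤ moveCost k j (k + 1) := by
  have h0 := extSize_pos_real k
  have h1 := half_le_moveCost_sub k j hjk
  have h2 : (1 / 2 : ℝ) ≤ if k = 1 then 2 / 3 else 1 / 2 := by split_ifs <;> norm_num
  rw [moveCost_split hjk (by omega)]
  simp only [climb, sharedClimb, Finset.Ico_self, Finset.sum_empty, Nat.Ico_succ_singleton,
    Finset.sum_singleton, mul_zero]
  rw [mul_div_cancel₀ _ h0.ne']
  linarith

/-! ### Extremal balanced trees -/

/-- `s` is the parent map of an extremal balanced tree of height `h` with root `r`, in which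
`L v` is the distance from `v` to the leaves. -/
structure IsExtremalTree {V : Type*} (h : ℕ) (r : V) (s : V → V) (L : V → ℕ) : Prop where
  map_root : s r = r
  level_root : L r = h
  level_le : ∀ v, L v ≤ h
  level_map : ∀ v, v ≠ r → L (s v) = L v + 1
  card_children : ∀ v, {u : V | u ≠ r ∧ s u = v}.ncard = extDeg (L v)

theorem exists_isExtremalTree (h : ℕ) :
    ∃ (V : Type) (_ : Fintype V) (r : V) (s : V → V) (L : V → ℕ),
      Fintype.card V = extSize h ∧ IsExtremalTree h r s L := by
  induction h with
  | zero =>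
    exact ⟨Unit, inferInstance, (), id, fun _ => 0, rfl, rfl, rfl, fun _ => le_rfl,
      fun v hv => absurd rfl hv, fun v => by simp [extDeg]⟩
  | succ h ih =>
    obtain ⟨V, _, r, s, L, hcard, T⟩ := ih
    refine ⟨Option (Fin (extDeg (h + 1)) × V), inferInstance, none,
      fun o => o.elim none fun p => if p.2 = r then none else some (p.1, s p.2),
      fun o => o.elim (h + 1) fun p => L p.2, ?_, rfl, rfl, ?_, ?_, ?_⟩
    · simp [extSize, hcard]
    · rintro (_ | ⟨c, x⟩)
      · exact le_rfl
      · exact (T.level_le x).trans (Nat.le_succ h)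
    · rintro (_ | ⟨c, x⟩) hv
      · exact absurd rfl hv
      · by_cases hx : x = r
        · simp [hx, T.level_root]
        · simp [hx, T.level_map x hx]
    · rintro (_ | ⟨c, x⟩)
      · have : {u : Option (Fin (extDeg (h + 1)) × V) | u ≠ none ∧
            (u.elim none fun p => if p.2 = r then none else some (p.1, s p.2)) = none} =
            Set.range fun c => some (c, r) := by
          ext (_ | ⟨c, x⟩)
          · simp
          · simp [eq_comm]
        rw [this, ← Set.image_univ, Set.ncard_image_of_injective _ fun a b hab => by simpa using hab,
          Set.ncard_univ]
        simp
      · have : {u : Option (Fin (extDeg (h + 1)) × V) | u ≠ none ∧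
            (u.elim none fun p => if p.2 = r then none else some (p.1, s p.2)) = some (c, x)} =
            (fun y => some (c, y)) '' {u | u ≠ r ∧ s u = x} := by
          ext (_ | ⟨d, y⟩)
          · simp
          · by_cases hy : y = r
            · simp [hy]
            · simp [hy]
              grind
        rw [this, Set.ncard_image_of_injective _ fun a b hab => by simpa using hab,
          T.card_children]
        rfl

theorem exists_isExtremalTree_fin (h : ℕ) :
    ∃ (s : Fin (extSize h - 1 + 1) → Fin (extSize h - 1 + 1)) (L : Fin (extSize h - 1 + 1) → ℕ),
      IsExtremalTree h 0 s L := by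
  obtain ⟨V, _, r, s, L, hcard, T⟩ := exists_isExtremalTree h
  have hc : Fintype.card V = extSize h - 1 + 1 := by
    rw [hcard, Nat.sub_add_cancel (extSize_pos h)]
  obtain ⟨e, he⟩ : ∃ e : V ≃ Fin (extSize h - 1 + 1), e r = 0 :=
    ⟨(Fintype.equivFinOfCardEq hc).trans (Equiv.swap (Fintype.equivFinOfCardEq hc r) 0), by simp⟩
  have he' : e.symm 0 = r := by simp [← he]
  refine ⟨e ∘ s ∘ e.symm, L ∘ e.symm, ?_, ?_, fun v => T.level_le _, fun v hv => ?_, fun v => ?_⟩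
  · simp [he', T.map_root, he]
  · simp [he', T.level_root]
  · have : e.symm v ≠ r := fun h => hv (by rw [← he, ← h, e.apply_symm_apply])
    simp [T.level_map _ this]
  · have : {u | u ≠ 0 ∧ (e ∘ s ∘ e.symm) u = v} = e '' {u | u ≠ r ∧ s u = e.symm v} := by
      ext u
      rw [Equiv.image_eq_preimage_symm]
      simp [← he', Equiv.eq_symm_apply]
    rw [this, Set.ncard_image_of_injective _ e.injective, T.card_children]
    rfl

/-- The sum, over the nodes of a subtree of height `k`, of a function of the level. -/
def levelSum (F : ℕ → ℝ) : ℕ → ℝ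
  | 0 => F 0
  | (k + 1) => F (k + 1) + extDeg (k + 1) * levelSum F k

theorem levelSum_one : ∀ k, levelSum (fun _ => 1) k = extSize k
  | 0 => by simp [levelSum, extSize]
  | k + 1 => by simp [levelSum, extSize, levelSum_one k, add_comm]

theorem levelSum_climb {h : ℕ} :
    ∀ {k : ℕ}, k ≤ h → levelSum (fun l => climb l h) k = extSize k * climb k h + extSC k
  | 0, _ => by simp [levelSum, extSize, extSC]
  | k + 1, hk => by
    have h0 := extSize_pos_real k
    have h1 : climb k h = extDeg (k + 1) / extSize k + climb (k + 1) h := by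
      simp only [climb]
      rw [Finset.sum_eq_sum_Ico_succ_bot (by omega)]
    simp only [levelSum, extSize, extSC]
    rw [levelSum_climb (by omega), h1]
    push_cast
    field_simp
    ring

/-- The nodes having a directed path to `u`. -/
def subtree (s : Fin (n + 1) → Fin (n + 1)) (u : Fin (n + 1)) : Finset (Fin (n + 1)) :=
  Finset.univ.filter fun w => ∃ k, s^[k] w = u

theorem mem_subtree {s : Fin (n + 1) → Fin (n + 1)} {u w : Fin (n + 1)} :
    w ∈ subtree s u ↔ ∃ k, s^[k] w = u := by
  simp [subtree]

theorem subtreeSize_eq_card (s : Fin (n + 1) → Fin (n + 1)) (u : Fin (n + 1)) :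
    subtreeSize s u = (subtree s u).card := by
  rw [subtreeSize, Nat.card_eq_fintype_card, Fintype.card_ofFinset]
  simp [subtree]

theorem self_mem_subtree (s : Fin (n + 1) → Fin (n + 1)) (u : Fin (n + 1)) : u ∈ subtree s u :=
  mem_subtree.2 ⟨0, rfl⟩

theorem subtreeSize_pos (s : Fin (n + 1) → Fin (n + 1)) (u : Fin (n + 1)) :
    0 < subtreeSize s u := by
  rw [subtreeSize_eq_card]
  exact Finset.card_pos.2 ⟨u, self_mem_subtree s u⟩

theorem subtree_subset {s : Fin (n + 1) → Fin (n + 1)} {u v : Fin (n + 1)}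
    (hv : v ∈ subtree s u) : subtree s v ⊆ subtree s u := by
  intro w hw
  obtain ⟨a, rfl⟩ := mem_subtree.1 hw
  obtain ⟨b, rfl⟩ := mem_subtree.1 hv
  exact mem_subtree.2 ⟨b + a, Function.iterate_add_apply s b a w⟩

theorem cost_eq_ofReal {r : Fin (n + 1)} {s : Fin (n + 1) → Fin (n + 1)} {v : Fin (n + 1)} {K : ℕ}
    (hK : s^[K] v = r) (hlt : ∀ i < K, s^[i] v ≠ r) :
    cost r s v = ENNReal.ofReal (∑ k ∈ Finset.range K,
      (indeg r s (s^[k + 1] v) : ℝ) / subtreeSize s (s^[k] v)) := by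
  have h : ∃ k, s^[k] v = r := ⟨K, hK⟩
  have hfind : Nat.find h = K := (Nat.find_eq_iff h).2 ⟨hK, hlt⟩
  rw [cost, dif_pos h, hfind, ENNReal.ofReal_sum_of_nonneg fun i _ => by positivity]
  refine Finset.sum_congr rfl fun k _ => ?_
  rw [ENNReal.ofReal_div_of_pos (by exact_mod_cast subtreeSize_pos s _), ENNReal.ofReal_natCast,
    ENNReal.ofReal_natCast]

namespace IsExtremalTree

variable {h : ℕ} {s : Fin (n + 1) → Fin (n + 1)} {L : Fin (n + 1) → ℕ}

theorem level_eq_iff (T : IsExtremalTree h 0 s L) {v : Fin (n + 1)} : L v = h ↔ v = 0 := by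
  refine ⟨fun hv => ?_, fun hv => hv ▸ T.level_root⟩
  by_contra h0
  have := T.level_map v h0
  have := T.level_le (s v)
  omega

theorem level_iterate (T : IsExtremalTree h 0 s L) (v : Fin (n + 1)) (i : ℕ) :
    L (s^[i] v) = min (L v + i) h := by
  induction i with
  | zero => simpa using T.level_le v
  | succ i ih =>
    rw [Function.iterate_succ_apply']
    by_cases h0 : s^[i] v = 0
    · rw [h0, T.level_root] at ih
      rw [h0, T.map_root, T.level_root]
      omega
    · have := T.level_map _ h0
      have := T.level_le (s (s^[i] v))
      omega

theorem iterate_eq_root_iff (T : IsExtremalTree h 0 s L) {v : Fin (n + 1)} {i : ℕ} :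
    s^[i] v = 0 ↔ h ≤ L v + i := by
  rw [← T.level_eq_iff, T.level_iterate]
  omega

theorem level_le_of_mem_subtree (T : IsExtremalTree h 0 s L) {u w : Fin (n + 1)}
    (hw : w ∈ subtree s u) : L w ≤ L u := by
  obtain ⟨k, rfl⟩ := mem_subtree.1 hw
  have := T.level_iterate w k
  have := T.level_le w
  omega

theorem iterate_of_mem_subtree (T : IsExtremalTree h 0 s L) {u w : Fin (n + 1)}
    (hw : w ∈ subtree s u) : s^[L u - L w] w = u := by
  have hle := T.level_le w
  obtain ⟨k, hk⟩ := mem_subtree.1 hw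
  have hL := T.level_iterate w k
  rw [hk] at hL
  by_cases h0 : u = 0
  · subst h0
    rw [T.iterate_eq_root_iff, T.level_root]
    omega
  · have : L u ≠ h := fun h' => h0 (T.level_eq_iff.1 h')
    rwa [show L u - L w = k by omega]

theorem indeg_eq (T : IsExtremalTree h 0 s L) (v : Fin (n + 1)) :
    indeg 0 s v = extDeg (L v) :=
  T.card_children v

theorem subtree_eq (T : IsExtremalTree h 0 s L) (u : Fin (n + 1)) :
    subtree s u =
      insert u ((Finset.univ.filter fun c => c ≠ 0 ∧ s c = u).biUnion (subtree s)) := by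
  ext w
  simp only [Finset.mem_insert, Finset.mem_biUnion, Finset.mem_filter, Finset.mem_univ, true_and,
    mem_subtree]
  constructor
  · rintro ⟨k, hk⟩
    induction k with
    | zero => exact Or.inl hk
    | succ k ih =>
      rw [Function.iterate_succ_apply'] at hk
      by_cases h0 : s^[k] w = 0
      · refine ih ?_
        rw [h0, T.map_root] at hk
        rw [h0, hk]
      · exact Or.inr ⟨_, ⟨h0, hk⟩, k, rfl⟩
  · rintro (rfl | ⟨c, ⟨-, rfl⟩, k, rfl⟩)
    · exact ⟨0, rfl⟩
    · exact ⟨k + 1, Function.iterate_succ_apply' s k w⟩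

theorem sum_subtree (T : IsExtremalTree h 0 s L) (F : ℕ → ℝ) (u : Fin (n + 1)) :
    ∑ w ∈ subtree s u, F (L w) = levelSum F (L u) := by
  have hcard : (Finset.univ.filter fun c => c ≠ 0 ∧ s c = u).card = extDeg (L u) := by
    rw [← T.card_children u, ← Set.ncard_coe_finset]
    simp
  generalize hl : L u = l at *
  induction l generalizing u with
  | zero =>
    rw [extDeg, Finset.card_eq_zero] at hcard
    rw [T.subtree_eq, hcard]
    simp [levelSum, hl]
  | succ l ih =>
    have hL : ∀ c ∈ Finset.univ.filter fun c => c ≠ 0 ∧ s c = u, L c = l := by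
      intro c hc
      simp only [Finset.mem_filter, Finset.mem_univ, true_and] at hc
      have := T.level_map c hc.1
      rw [hc.2] at this
      omega
    rw [T.subtree_eq, Finset.sum_insert, Finset.sum_biUnion]
    · have : ∀ c ∈ Finset.univ.filter fun c => c ≠ 0 ∧ s c = u,
          ∑ w ∈ subtree s c, F (L w) = levelSum F l := fun c hc => by
        refine ih c (hL c hc) ?_
        rw [← hL c hc, ← T.card_children c, ← Set.ncard_coe_finset]
        simp
      rw [Finset.sum_congr rfl this, Finset.sum_const, hcard, nsmul_eq_mul, hl, levelSum]
    · intro c hc d hd hcd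
      refine Finset.disjoint_left.2 fun w hwc hwd => hcd ?_
      rw [← T.iterate_of_mem_subtree hwc, ← T.iterate_of_mem_subtree hwd, hL c hc, hL d hd]
    · simp only [Finset.mem_biUnion, not_exists, not_and]
      intro c hc hu
      have := T.level_le_of_mem_subtree hu
      rw [hL c hc] at this
      omega

theorem subtreeSize_eq (T : IsExtremalTree h 0 s L) (u : Fin (n + 1)) :
    subtreeSize s u = extSize (L u) := by
  have := T.sum_subtree (fun _ => 1) u
  rw [levelSum_one, Finset.sum_const, nsmul_one, ← subtreeSize_eq_card] at this
  exact_mod_cast this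

theorem cost_eq (T : IsExtremalTree h 0 s L) (v : Fin (n + 1)) :
    cost 0 s v = ENNReal.ofReal (climb (L v) h) := by
  have hle := T.level_le v
  rw [cost_eq_ofReal (K := h - L v) (T.iterate_eq_root_iff.2 (by omega))
    fun i hi => by rw [Ne, T.iterate_eq_root_iff]; omega]
  congr 1
  rw [climb, Finset.sum_Ico_eq_sum_range]
  refine Finset.sum_congr rfl fun i hi => ?_
  rw [Finset.mem_range] at hi
  rw [T.indeg_eq, T.subtreeSize_eq, T.level_iterate, T.level_iterate, min_eq_left (by omega),
    min_eq_left (by omega), add_assoc]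

theorem SC_eq (T : IsExtremalTree h 0 s L) : SC s = (extSC h : ℝ≥0∞) := by
  have h0 : climb h h = 0 := by simp [climb]
  have huniv : subtree s 0 = Finset.univ := by
    ext w
    simp only [mem_subtree, Finset.mem_univ, iff_true]
    exact ⟨h, T.iterate_eq_root_iff.2 (by omega)⟩
  have hsum := T.sum_subtree (fun l => climb l h) 0
  rw [huniv, T.level_root, levelSum_climb le_rfl, h0, mul_zero, zero_add] at hsum
  rw [SC, Finset.sum_congr rfl fun v _ => T.cost_eq v,
    ← ENNReal.ofReal_sum_of_nonneg fun v _ => climb_nonneg _ _, ← ENNReal.ofReal_natCast, ← hsum,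
    ← Finset.add_sum_erase _ _ (Finset.mem_univ (0 : Fin (n + 1))), T.level_root, h0, zero_add]

theorem exists_leaf (T : IsExtremalTree h 0 s L) : ∃ v, L v = 0 := by
  obtain ⟨v, hv⟩ := Finite.exists_min L
  refine ⟨v, ?_⟩
  by_contra hne
  obtain ⟨k, hk⟩ := Nat.exists_eq_succ_of_ne_zero hne
  have hpos : {u | u ≠ 0 ∧ s u = v}.ncard ≠ 0 := by
    rw [T.card_children, hk]
    exact (extDeg_pos k).ne'
  obtain ⟨u, hu0, hu⟩ := Set.nonempty_of_ncard_ne_zero hpos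
  have h1 := T.level_map u hu0
  have h2 := hv u
  rw [hu] at h1
  omega

theorem height_eq (T : IsExtremalTree h 0 s L) : height s = h := by
  obtain ⟨v, hv⟩ := T.exists_leaf
  refine le_antisymm (Nat.sInf_le fun w => T.iterate_eq_root_iff.2 (by omega)) ?_
  refine le_csInf ⟨h, fun w => T.iterate_eq_root_iff.2 (by omega)⟩ fun k hk => ?_
  have := T.iterate_eq_root_iff.1 (hk v)
  omega

end IsExtremalTree

/-! ### Deviations -/

theorem iterate_update_of_forall_ne {s : Fin (n + 1) → Fin (n + 1)} {v w x : Fin (n + 1)} {k : ℕ}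
    (hx : ∀ i < k, s^[i] x ≠ v) : (Function.update s v w)^[k] x = s^[k] x := by
  induction k with
  | zero => rfl
  | succ k ih =>
    rw [Function.iterate_succ_apply', Function.iterate_succ_apply',
      ih fun i hi => hx i (by omega), Function.update_of_ne (hx k (by omega))]

theorem subtree_update_subset (s : Fin (n + 1) → Fin (n + 1)) (v w x : Fin (n + 1)) :
    subtree (Function.update s v w) x ⊆ subtree s x ∪ subtree s v := by
  intro y hy
  rw [Finset.mem_union]
  by_cases hyv : y ∈ subtree s v
  · exact Or.inr hyv
  · obtain ⟨k, hk⟩ := mem_subtree.1 hy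
    refine Or.inl (mem_subtree.2 ⟨k, ?_⟩)
    rwa [iterate_update_of_forall_ne fun i _ hi => hyv (mem_subtree.2 ⟨i, hi⟩)] at hk

theorem subtreeSize_update_le_add (s : Fin (n + 1) → Fin (n + 1)) (v w x : Fin (n + 1)) :
    subtreeSize (Function.update s v w) x ≤ subtreeSize s x + subtreeSize s v := by
  simp only [subtreeSize_eq_card]
  exact (Finset.card_le_card (subtree_update_subset s v w x)).trans (Finset.card_union_le _ _)

theorem subtreeSize_update_le {s : Fin (n + 1) → Fin (n + 1)} {v x : Fin (n + 1)}
    (hv : v ∈ subtree s x) (w : Fin (n + 1)) :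
    subtreeSize (Function.update s v w) x ≤ subtreeSize s x := by
  simp only [subtreeSize_eq_card]
  refine Finset.card_le_card ((subtree_update_subset s v w x).trans ?_)
  exact Finset.union_subset subset_rfl (subtree_subset hv)

theorem indeg_le_indeg_update {r v x : Fin (n + 1)} {s : Fin (n + 1) → Fin (n + 1)}
    (hx : x ≠ s v) (w : Fin (n + 1)) : indeg r s x ≤ indeg r (Function.update s v w) x := by
  refine Set.ncard_le_ncard (fun u ⟨hu, hux⟩ => ⟨hu, ?_⟩) (Set.toFinite _)
  rw [Function.update_of_ne, hux]
  rintro rfl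
  exact hx hux.symm

theorem indeg_le_indeg_update_add_one (r v x w : Fin (n + 1)) (s : Fin (n + 1) → Fin (n + 1)) :
    indeg r s x ≤ indeg r (Function.update s v w) x + 1 := by
  refine le_trans (Set.ncard_le_ncard (t := insert v {u | u ≠ r ∧ Function.update s v w u = x})
    (fun u ⟨hu, hux⟩ => ?_) (Set.toFinite _)) (Set.ncard_insert_le _ _)
  by_cases huv : u = v
  · exact Or.inl huv
  · exact Or.inr ⟨hu, by rw [Function.update_of_ne huv, hux]⟩

theorem indeg_update_self {r v w : Fin (n + 1)} {s : Fin (n + 1) → Fin (n + 1)}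
    (hv : v ≠ r) (hw : w ≠ s v) : indeg r s w + 1 ≤ indeg r (Function.update s v w) w := by
  have hnot : v ∉ {u | u ≠ r ∧ s u = w} := fun h => hw h.2.symm
  refine le_trans (Set.ncard_insert_of_notMem hnot (Set.toFinite _)).ge
    (Set.ncard_le_ncard ?_ (Set.toFinite _))
  rintro u (rfl | ⟨hu, hux⟩)
  · exact ⟨hv, by simp⟩
  · refine ⟨hu, ?_⟩
    rw [Function.update_of_ne, hux]
    rintro rfl
    exact hw hux.symm

theorem cost_update_eq_top {r v w : Fin (n + 1)} {s : Fin (n + 1) → Fin (n + 1)}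
    (hr : s r = r) (hv : v ≠ r) (hw : w ∈ subtree s v) :
    cost r (Function.update s v w) v = ⊤ := by
  have hinv : ∀ k, (Function.update s v w)^[k] v ∈ subtree s v := by
    intro k
    induction k with
    | zero => exact self_mem_subtree s v
    | succ k ih =>
      rw [Function.iterate_succ_apply']
      by_cases hk : (Function.update s v w)^[k] v = v
      · rwa [hk, Function.update_self]
      · rw [Function.update_of_ne hk]
        obtain ⟨_ | j, hj⟩ := mem_subtree.1 ih
        · exact absurd hj hk
        · exact mem_subtree.2 ⟨j, hj⟩
  refine dif_neg ?_
  rintro ⟨k, hk⟩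
  obtain ⟨j, hj⟩ := mem_subtree.1 (hinv k)
  rw [hk, Function.iterate_fixed hr] at hj
  exact hv hj.symm

theorem climb_le_sum {j k m h : ℕ} (hkm : k < m) (hjm : j ≤ m) (hmh : m ≤ h)
    (hjk : m = k + 1 → j ≤ k) {g : ℕ → ℝ}
    (hg : ∀ l, g l = if l < m then (extDeg (l + 1) : ℝ) / ((extSize l : ℝ) + extSize k) -
      (if l = k then (if m = k + 1 then 1 / (2 * (extSize k : ℝ)) else 0) else 0)
      else (extDeg (l + 1) : ℝ) / extSize l) :
    climb k h ≤ ((extDeg j : ℝ) + 1) / extSize k + ∑ l ∈ Finset.Ico j h, g l := by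
  have h0 := extSize_pos_real k
  have hsplit : climb k h = climb k m + climb m h :=
    (Finset.sum_Ico_consecutive _ hkm.le hmh).symm
  have htop : ∑ l ∈ Finset.Ico m h, g l = climb m h :=
    Finset.sum_congr rfl fun l hl => by
      rw [hg, if_neg (not_lt.2 (Finset.mem_Ico.1 hl).1)]
  have hbot : ∑ l ∈ Finset.Ico j m, g l =
      sharedClimb k j m - if m = k + 1 then 1 / (2 * (extSize k : ℝ)) else 0 := by
    rw [Finset.sum_congr rfl fun l hl => (hg l).trans (if_pos (Finset.mem_Ico.1 hl).2),
      Finset.sum_sub_distrib, Finset.sum_ite_eq', ← sharedClimb]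
    congr 1
    by_cases hm : m = k + 1
    · rw [if_pos (Finset.mem_Ico.2 ⟨hjk hm, hkm⟩)]
    · simp [hm]
  have hmove : ((extDeg j : ℝ) + 1) / extSize k + sharedClimb k j m =
      moveCost k j m / extSize k := by
    rw [moveCost]
    field_simp
  rw [← Finset.sum_Ico_consecutive _ hjm hmh, htop, hbot, hsplit]
  suffices climb k m + (if m = k + 1 then 1 / (2 * (extSize k : ℝ)) else 0) ≤
      moveCost k j m / extSize k by linarith
  rw [le_div_iff₀ h0]
  split_ifs with hm
  · subst hm
    have := climb_succ_le_moveCost (hjk rfl)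
    have h2 : 1 / (2 * (extSize k : ℝ)) * extSize k = 1 / 2 := by field_simp
    linarith
  · have := climb_le_moveCost hjm hkm
    linarith

namespace IsExtremalTree

variable {h : ℕ} {s : Fin (n + 1) → Fin (n + 1)} {L : Fin (n + 1) → ℕ}

/-- The cost of a deviation, bounded below level by level. -/
theorem sum_update_le_cost_update (T : IsExtremalTree h 0 s L) {v w : Fin (n + 1)} (hv : v ≠ 0)
    (hw : w ∉ subtree s v) (hwv : w ≠ s v) {g : ℕ → ℝ}
    (hg : ∀ i < h - L w, g (L w + i) ≤
      (indeg 0 (Function.update s v w) (s^[i + 1] w) : ℝ) /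
        subtreeSize (Function.update s v w) (s^[i] w)) :
    ENNReal.ofReal (((extDeg (L w) : ℝ) + 1) / extSize (L v) + ∑ l ∈ Finset.Ico (L w) h, g l) ≤
      cost 0 (Function.update s v w) v := by
  have hle := T.level_le w
  have hit : ∀ i, (Function.update s v w)^[i + 1] v = s^[i] w := fun i => by
    rw [Function.iterate_succ_apply, Function.update_self,
      iterate_update_of_forall_ne fun j _ hj => hw (mem_subtree.2 ⟨j, hj⟩)]
  rw [cost_eq_ofReal (K := h - L w + 1)]
  · refine ENNReal.ofReal_le_ofReal ?_
    rw [Finset.sum_range_succ', add_comm, Finset.sum_Ico_eq_sum_range]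
    refine add_le_add (Finset.sum_le_sum fun i hi => ?_) ?_
    · rw [hit, hit]
      exact hg i (Finset.mem_range.1 hi)
    · rw [hit]
      have h1 := indeg_update_self hv hwv
      have h2 := subtreeSize_update_le (self_mem_subtree s v) w
      have h3 := subtreeSize_pos (Function.update s v w) v
      rw [T.indeg_eq] at h1
      rw [T.subtreeSize_eq] at h2
      simp only [Function.iterate_zero, id]
      gcongr
      exact_mod_cast h1
  · rw [hit, T.iterate_eq_root_iff]
    omega
  · rintro (_ | i) hi
    · exact hv
    · rw [hit, Ne, T.iterate_eq_root_iff]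
      omega

theorem isStable (T : IsExtremalTree h 0 s L) : IsStable 0 s := by
  refine ⟨⟨T.map_root, fun v hv hs => ?_⟩, fun v hv w hw => ?_⟩
  · have := T.level_map v hv
    rw [hs] at this
    omega
  by_cases hwv : w ∈ subtree s v
  · rw [cost_update_eq_top T.map_root hv hwv]
    exact le_top
  by_cases hws : w = s v
  · rw [hws, Function.update_eq_self]
  have hreach : ∃ t, v ∈ subtree s (s^[t] w) :=
    ⟨h, mem_subtree.2 ⟨h, by
      rw [T.iterate_eq_root_iff.2 (by omega), T.iterate_eq_root_iff.2 (by omega)]⟩⟩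
  obtain ⟨t, ht, htmin⟩ : ∃ t, v ∈ subtree s (s^[t] w) ∧ ∀ i < t, v ∉ subtree s (s^[i] w) :=
    ⟨Nat.find hreach, Nat.find_spec hreach, fun i hi => Nat.find_min hreach hi⟩
  have hmono : ∀ i, t ≤ i → v ∈ subtree s (s^[i] w) := fun i hi => by
    refine subtree_subset (mem_subtree.2 ⟨i - t, ?_⟩) ht
    rw [← Function.iterate_add_apply, Nat.sub_add_cancel hi]
  have hLv := T.level_le v
  have hLw := T.level_le w
  have hth : L w + t ≤ h := by
    by_contra hlt
    refine htmin (h - L w) (by omega) ?_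
    rw [T.iterate_eq_root_iff.2 (by omega)]
    exact mem_subtree.2 ⟨h, T.iterate_eq_root_iff.2 (by omega)⟩
  have hLt : L (s^[t] w) = L w + t := by
    rw [T.level_iterate, min_eq_left hth]
  have hkm : L v < L w + t := by
    rw [← hLt]
    refine lt_of_le_of_ne (T.level_le_of_mem_subtree ht) fun heq => ?_
    have := T.iterate_of_mem_subtree ht
    rw [heq, Nat.sub_self] at this
    exact hwv (mem_subtree.2 ⟨t, this.symm⟩)
  have hjk : L w + t = L v + 1 → L w ≤ L v := fun heq => by
    by_contra hlt
    obtain rfl : t = 0 := by omega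
    have := T.iterate_of_mem_subtree ht
    rw [hLt, heq, show L v + 1 - L v = 1 by omega] at this
    exact hws this.symm
  rw [T.cost_eq]
  refine le_trans (ENNReal.ofReal_le_ofReal (climb_le_sum hkm (Nat.le_add_right _ _) hth hjk
    fun l => rfl)) (T.sum_update_le_cost_update hv hwv hws fun i hi => ?_)
  have hLi : L (s^[i] w) = L w + i := by rw [T.level_iterate, min_eq_left (by omega)]
  have hLi' : L (s^[i + 1] w) = L w + i + 1 := by
    rw [T.level_iterate, min_eq_left (by omega), add_assoc]
  have hpos : (0 : ℝ) < subtreeSize (Function.update s v w) (s^[i] w) := by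
    exact_mod_cast subtreeSize_pos _ _
  have hLsv := T.level_map v hv
  by_cases hit : i < t
  · rw [if_pos (by omega)]
    have hsize : (subtreeSize (Function.update s v w) (s^[i] w) : ℝ) ≤
        (extSize (L w + i) : ℝ) + extSize (L v) := by
      have := subtreeSize_update_le_add s v w (s^[i] w)
      rw [T.subtreeSize_eq, T.subtreeSize_eq, hLi] at this
      exact_mod_cast this
    by_cases hx : s^[i + 1] w = s v
    · have hti : i + 1 = t := by
        by_contra hne
        refine htmin (i + 1) (by omega) ?_
        rw [hx]
        exact mem_subtree.2 ⟨1, rfl⟩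
      have hik : L w + i = L v := by rw [hx, hLsv] at hLi'; omega
      have hdeg : (extDeg (L v + 1) : ℝ) ≤
          indeg 0 (Function.update s v w) (s^[i + 1] w) + 1 := by
        have := indeg_le_indeg_update_add_one 0 v (s^[i + 1] w) w s
        rw [T.indeg_eq, hLi', hik] at this
        exact_mod_cast this
      have h0 := extSize_pos_real (L v)
      rw [if_pos hik, if_pos (by omega), hik]
      rw [hik] at hsize
      calc _ = ((extDeg (L v + 1) : ℝ) - 1) / ((extSize (L v) : ℝ) + extSize (L v)) := by
            rw [← two_mul]
            ring
        _ ≤ (indeg 0 (Function.update s v w) (s^[i + 1] w) : ℝ) /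
            ((extSize (L v) : ℝ) + extSize (L v)) := by
          gcongr
          linarith
        _ ≤ _ := by gcongr
    · have hdeg := indeg_le_indeg_update (r := 0) hx w
      rw [T.indeg_eq, hLi'] at hdeg
      refine (sub_le_self _ (by split_ifs <;> positivity)).trans ?_
      gcongr
  · rw [if_neg (by omega)]
    have hsize := subtreeSize_update_le (hmono i (not_lt.1 hit)) w
    rw [T.subtreeSize_eq, hLi] at hsize
    have hx : s^[i + 1] w ≠ s v := fun hx => by
      rw [hx, hLsv] at hLi'
      omega
    have hdeg := indeg_le_indeg_update (r := 0) hx w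
    rw [T.indeg_eq, hLi'] at hdeg
    gcongr

end IsExtremalTree

/-- For every `h ≥ 7`, the extremal balanced tree `𝒯_h` (the balanced
tree of height `h` whose level at distance `i` from the root has in-degree
`extDeg (h − i)`) is a stable tree with `n_h − 1` agents, whose social cost is `sc_h`,
and `sc_h > 2.4317 · (n_h − 1)`; hence the Price of Anarchy is at least `2.4317`. -/
theorem price_of_anarchy_lower_bound :
    ∀ h : ℕ, 7 ≤ h →
      (∃ s : Fin (extSize h - 1 + 1) → Fin (extSize h - 1 + 1),
        IsStable 0 s ∧ (∀ v, ∃ k, s^[k] v = 0) ∧ height s = h ∧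
        (∀ (v : Fin (extSize h - 1 + 1)) (k : ℕ), s^[k] v = 0 → (∀ j < k, s^[j] v ≠ 0) →
          indeg 0 s v = extDeg (h - k)) ∧
        SC s = (extSC h : ℝ≥0∞)) ∧
      (2.4317 : ℝ) * ((extSize h : ℝ) - 1) < (extSC h : ℝ) := by
  intro h hh
  obtain ⟨s, L, T⟩ := exists_isExtremalTree_fin h
  refine ⟨⟨s, T.isStable, fun v => ⟨h, T.iterate_eq_root_iff.2 (by omega)⟩, T.height_eq,
    fun v k hk hlt => ?_, T.SC_eq⟩, lt_extSC hh⟩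
  have hle := T.level_le v
  have h1 := T.iterate_eq_root_iff.1 hk
  have h2 : ¬ h - L v < k := fun hlt' =>
    hlt _ hlt' (T.iterate_eq_root_iff.2 (by omega))
  rw [T.indeg_eq, show L v = h - k by omega]

end TCG
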